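/- arXiv:2205.06033 — 2 statements merged into one kernel-verified Lean document; each statement's English description precedes it below -/
import Mathlib

section
/- For every positive integer s there exists a constant Γ(s), depending only on s, such that for all positive integers L, k, N with L ≥ 3, s+1 ≤ k ≤ L+s and N ≥ Γ(s), the number of partitions of N lying in I_{L,s,{k}} is strictly greater than the number of partitions of N lying in D_{L,s}. -/
open Finset PowerSeries

/-- The multisets of positive integers from `S` with sum `n`. -/
def partsIn (S : Finset ℕ) (n : ℕ) : Finset (Multiset ℕ) :=
  ((univ : Finset n.Partition).image Nat.Partition.parts).filter fun m => ∀ x ∈ m, x ∈ S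

lemma mem_partsIn {S : Finset ℕ} (hS : 0 ∉ S) {n : ℕ} {m : Multiset ℕ} :
    m ∈ partsIn S n ↔ m.sum = n ∧ ∀ x ∈ m, x ∈ S := by
  simp only [partsIn, mem_filter, mem_image, mem_univ, true_and]
  refine and_congr_left fun h => ⟨?_, fun hm => ?_⟩
  · rintro ⟨p, rfl⟩
    exact p.parts_sum
  · exact ⟨⟨m, fun {i} hi => Nat.pos_of_ne_zero fun h0 => hS (h0 ▸ h i hi), hm⟩, rfl⟩

lemma card_partsIn_zero {S : Finset ℕ} (hS : 0 ∉ S) : #(partsIn S 0) = 1 := by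
  refine card_eq_one.2 ⟨0, ?_⟩
  ext m
  rw [mem_partsIn hS, mem_singleton]
  refine ⟨fun ⟨h, h'⟩ => ?_, ?_⟩
  · refine Multiset.eq_zero_of_forall_notMem fun x hx => ?_
    have := Multiset.le_sum_of_mem hx
    have h0 : x = 0 := by omega
    exact hS (h0 ▸ h' x hx)
  · rintro rfl
    simp

lemma card_partsIn_empty (n : ℕ) : #(partsIn ∅ n) = if n = 0 then 1 else 0 := by
  split_ifs with h
  · subst h
    exact card_partsIn_zero (notMem_empty 0)
  · refine card_eq_zero.2 (eq_empty_of_forall_notMem fun m hm => ?_)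
    obtain ⟨h1, h2⟩ := (mem_partsIn (notMem_empty 0)).1 hm
    have : m = 0 := Multiset.eq_zero_of_forall_notMem fun x hx => notMem_empty x (h2 x hx)
    subst this
    exact h h1.symm

lemma filter_notMem_partsIn_insert {S : Finset ℕ} (hS : 0 ∉ S) {a : ℕ} (ha : 0 < a) (haS : a ∉ S)
    (n : ℕ) : (partsIn (insert a S) n).filter (a ∉ ·) = partsIn S n := by
  have h0 : 0 ∉ insert a S := by simp [hS, ha.ne]
  ext m
  simp only [mem_filter, mem_partsIn hS, mem_partsIn h0, mem_insert]
  constructor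
  · rintro ⟨⟨h1, h2⟩, h3⟩
    exact ⟨h1, fun x hx => (h2 x hx).resolve_left fun e => h3 (e ▸ hx)⟩
  · rintro ⟨h1, h2⟩
    exact ⟨⟨h1, fun x hx => .inr (h2 x hx)⟩, fun h => haS (h2 a h)⟩

lemma card_filter_mem_partsIn {S : Finset ℕ} (hS : 0 ∉ S) {a : ℕ} (ha : a ∈ S) (n : ℕ) :
    #((partsIn S (n + a)).filter (a ∈ ·)) = #(partsIn S n) := by
  symm
  refine card_bij (fun m _ => a ::ₘ m) (fun m hm => ?_) (fun m _ m' _ h => ?_) (fun m hm => ?_)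
  · obtain ⟨h1, h2⟩ := (mem_partsIn hS).1 hm
    rw [mem_filter, mem_partsIn hS, Multiset.sum_cons, h1]
    refine ⟨⟨add_comm _ _, fun x hx => ?_⟩, Multiset.mem_cons_self a m⟩
    rcases Multiset.mem_cons.1 hx with rfl | h
    exacts [ha, h2 x h]
  · simpa using h
  · rw [mem_filter, mem_partsIn hS] at hm
    obtain ⟨t, rfl⟩ := Multiset.exists_cons_of_mem hm.2
    rw [Multiset.sum_cons] at hm
    refine ⟨t, (mem_partsIn hS).2 ⟨by omega, fun x hx => hm.1.2 x (Multiset.mem_cons_of_mem hx)⟩,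
      rfl⟩

lemma card_partsIn_insert_add {S : Finset ℕ} (hS : 0 ∉ S) {a : ℕ} (ha : 0 < a) (haS : a ∉ S)
    (n : ℕ) :
    #(partsIn (insert a S) (n + a)) = #(partsIn (insert a S) n) + #(partsIn S (n + a)) := by
  have h0 : 0 ∉ insert a S := by simp [hS, ha.ne]
  rw [← card_filter_mem_partsIn h0 (mem_insert_self a S) n,
    ← filter_notMem_partsIn_insert hS ha haS, card_filter_add_card_filter_not]

lemma card_partsIn_insert_of_lt {S : Finset ℕ} (hS : 0 ∉ S) {a : ℕ} (haS : a ∉ S)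
    {n : ℕ} (hn : n < a) : #(partsIn (insert a S) n) = #(partsIn S n) := by
  have ha : 0 < a := by omega
  have h0 : 0 ∉ insert a S := by simp [hS, ha.ne]
  rw [← filter_notMem_partsIn_insert hS ha haS, filter_true_of_mem]
  intro m hm h
  have := Multiset.le_sum_of_mem h
  have := ((mem_partsIn h0).1 hm).1
  omega

lemma card_partsIn_insert {S : Finset ℕ} (hS : 0 ∉ S) {a : ℕ} (ha : 0 < a) (haS : a ∉ S) (n : ℕ) :
    #(partsIn (insert a S) n) = ∑ w ∈ range (n / a + 1), #(partsIn S (n - w * a)) := by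
  induction n using Nat.strong_induction_on with
  | _ n ih =>
    rcases lt_or_ge n a with h | h
    · rw [card_partsIn_insert_of_lt hS haS h, Nat.div_eq_of_lt h]
      simp
    · obtain ⟨n, rfl⟩ := Nat.exists_eq_add_of_le' h
      rw [card_partsIn_insert_add hS ha haS, ih n (by omega), Nat.add_div_right _ ha,
        sum_range_succ' _ (n / a + 1)]
      simp [add_mul, Nat.add_sub_add_right]

lemma card_partsIn_singleton {a : ℕ} (ha : 0 < a) (n : ℕ) :
    #(partsIn {a} n) = if a ∣ n then 1 else 0 := by
  rw [← insert_empty, card_partsIn_insert (notMem_empty 0) ha (notMem_empty a)]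
  simp only [card_partsIn_empty]
  rw [sum_ite, sum_const_zero, add_zero, sum_const, smul_eq_mul, mul_one]
  split_ifs with h
  · obtain ⟨c, rfl⟩ := h
    refine card_eq_one.2 ⟨c, ?_⟩
    ext w
    rw [Nat.mul_div_cancel_left _ ha, mem_filter, mem_range, mem_singleton, Nat.sub_eq_zero_iff_le,
      mul_comm, Nat.mul_le_mul_right_iff ha]
    omega
  · refine card_eq_zero.2 (filter_eq_empty_iff.2 fun w hw h' => h ?_)
    have : w * a ≤ n := (Nat.le_div_iff_mul_le ha).1 (by simpa [Nat.lt_succ_iff] using hw)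
    exact ⟨w, by rw [mul_comm]; omega⟩

/-- The generating function of partitions with parts in `S`. -/
noncomputable def partsGF (S : Finset ℕ) : ℤ⟦X⟧ := PowerSeries.mk fun n => (#(partsIn S n) : ℤ)

lemma partsGF_insert_mul {S : Finset ℕ} (hS : 0 ∉ S) {a : ℕ} (ha : 0 < a) (haS : a ∉ S) :
    partsGF (insert a S) * (1 - X ^ a) = partsGF S := by
  ext n
  rw [mul_sub, mul_one, map_sub, coeff_mul_X_pow', partsGF, partsGF, coeff_mk, coeff_mk]
  split_ifs with h
  · obtain ⟨n, rfl⟩ := Nat.exists_eq_add_of_le' h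
    rw [card_partsIn_insert_add hS ha haS, coeff_mk, Nat.add_sub_cancel]
    push_cast
    ring
  · rw [card_partsIn_insert_of_lt hS haS (by omega), sub_zero, coeff_mk]

lemma partsGF_mul_prod {S : Finset ℕ} (hS : 0 ∉ S) : partsGF S * ∏ a ∈ S, (1 - X ^ a) = 1 := by
  induction S using Finset.induction_on with
  | empty =>
    ext n
    simp [partsGF, card_partsIn_empty, coeff_one]
  | insert a S haS ih =>
    rw [mem_insert, not_or] at hS
    rw [prod_insert haS, ← mul_assoc, partsGF_insert_mul hS.2 (Nat.pos_of_ne_zero (Ne.symm hS.1)) haS,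
      ih hS.2]

lemma partsGF_union {S T : Finset ℕ} (hS : 0 ∉ S) (hT : 0 ∉ T) (h : Disjoint S T) :
    partsGF (S ∪ T) = partsGF S * partsGF T := by
  have h0 : 0 ∉ S ∪ T := by simp [hS, hT]
  have e := partsGF_mul_prod h0
  have eS := partsGF_mul_prod hS
  have eT := partsGF_mul_prod hT
  rw [prod_union h] at e
  linear_combination (partsGF S * partsGF T) * e - partsGF (S ∪ T) * eS -
    partsGF (S ∪ T) * partsGF S * (∏ a ∈ S, (1 - X ^ a)) * eT

lemma card_partsIn_union {S T : Finset ℕ} (hS : 0 ∉ S) (hT : 0 ∉ T) (h : Disjoint S T) (n : ℕ) :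
    (#(partsIn (S ∪ T) n) : ℤ) =
      ∑ u ∈ range (n + 1), (#(partsIn S (n - u)) : ℤ) * #(partsIn T u) := by
  have := congrArg (coeff n) (partsGF_union hS hT h)
  rw [mul_comm, coeff_mul, Nat.sum_antidiagonal_eq_sum_range_succ_mk] at this
  simpa [partsGF, mul_comm] using this

lemma exists_mul_count_ge {m : Multiset ℕ} {K : ℕ} (hm : K ^ 3 < m.sum) :
    ∃ r ∈ m, K ≤ m.count r * r := by
  by_contra! h
  have h1 : m.sum = ∑ r ∈ m.toFinset, m.count r * r := by
    simpa using Finset.sum_multiset_count m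
  have hsub : m.toFinset ⊆ range K := fun r hr => by
    have hr' := Multiset.mem_toFinset.1 hr
    exact mem_range.2 ((Nat.le_mul_of_pos_left r (Multiset.count_pos.2 hr')).trans_lt (h r hr'))
  have h2 : ∑ r ∈ m.toFinset, m.count r * r ≤ #m.toFinset * K := by
    rw [← smul_eq_mul]
    exact sum_le_card_nsmul _ _ _ fun r hr => (h r (Multiset.mem_toFinset.1 hr)).le
  have h3 := card_le_card hsub
  rw [card_range] at h3
  have h4 : #m.toFinset * K ≤ K * K := Nat.mul_le_mul_right _ h3
  have h5 : K * K ≤ K ^ 3 := by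
    rcases Nat.eq_zero_or_pos K with rfl | hK
    · simp
    · nlinarith [Nat.mul_le_mul_left (K * K) hK]
  omega

lemma card_partsIn_le_sum {S : Finset ℕ} (hS : 0 ∉ S) {K M : ℕ} (hM : K ^ 3 < M) :
    #(partsIn S M) ≤ ∑ t ∈ Icc K M, t * #(partsIn S (M - t)) := by
  have hsub : partsIn S M ⊆ (Icc K M).biUnion fun t => (Icc 1 t).biUnion fun r =>
      (partsIn S (M - t)).image (· + Multiset.replicate (t / r) r) := by
    intro m hm
    obtain ⟨h1, h2⟩ := (mem_partsIn hS).1 hm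
    obtain ⟨r, hr, hK⟩ := exists_mul_count_ge (m := m) (K := K) (by omega)
    have hr0 : 0 < r := Nat.pos_of_ne_zero fun h0 => hS (h0 ▸ h2 r hr)
    obtain ⟨q, hq⟩ := Multiset.le_iff_exists_add.1 (Multiset.le_count_iff_replicate_le.1 le_rfl :
      Multiset.replicate (m.count r) r ≤ m)
    have hsum : m.sum = m.count r * r + q.sum := by
      conv_lhs => rw [hq]
      simp
    have hle : r ≤ m.count r * r := Nat.le_mul_of_pos_left r (Multiset.count_pos.2 hr)
    simp only [mem_biUnion, mem_Icc, mem_image]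
    refine ⟨m.count r * r, ⟨hK, by omega⟩, r, ⟨hr0, hle⟩, q, (mem_partsIn hS).2
      ⟨by omega, fun x hx => h2 x (hq ▸ Multiset.mem_add.2 (.inr hx))⟩, ?_⟩
    rw [Nat.mul_div_cancel _ hr0, add_comm, ← hq]
  refine (card_le_card hsub).trans (card_biUnion_le.trans (sum_le_sum fun t _ => ?_))
  refine card_biUnion_le.trans ((sum_le_card_nsmul _ _ _ fun r _ => card_image_le).trans ?_)
  simp

lemma card_partsIn_pair {a b : ℕ} (ha : 0 < a) (hb : 0 < b) (hab : a.Coprime b) (hne : b ≠ a)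
    (m : ℕ) :
    a * b * #(partsIn {b, a} m) ≤ m + a * b ∧ m ≤ a * b * #(partsIn {b, a} m) + a * b := by
  obtain ⟨v, hv⟩ : ∃ v, v * b ≡ m [MOD a] := by
    obtain ⟨c, -, hc⟩ := Nat.exists_mul_mod_eq_of_coprime m hab.symm ha.ne'
    exact ⟨c, by rw [mul_comm]; exact hc⟩
  have hcount : #(partsIn {b, a} m) = (m / b + 1).count (· ≡ v [MOD a]) := by
    rw [card_partsIn_insert (by simp [ha.ne]) hb (by simpa using hne), Nat.count_eq_card_filter_range,
      card_filter]
    refine sum_congr rfl fun w hw => ?_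
    rw [card_partsIn_singleton ha]
    have hw' : w * b ≤ m :=
      (Nat.le_div_iff_mul_le hb).1 (by simpa [Nat.lt_succ_iff] using hw)
    refine if_congr ?_ rfl rfl
    rw [← Nat.modEq_iff_dvd' hw']
    exact ⟨fun h => Nat.ModEq.cancel_right_of_coprime hab (h.trans hv.symm),
      fun h => (h.mul_right b).trans hv⟩
  have hc := Nat.count_modEq_card (m / b + 1) ha v
  rw [← hcount] at hc
  generalize #(partsIn {b, a} m) = f at hc ⊢
  have hZ := Nat.div_add_mod (m / b + 1) a
  have hZ' := Nat.mod_lt (m / b + 1) ha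
  have hm := Nat.div_add_mod m b
  have hm' := Nat.mod_lt m hb
  have key : a * f ≤ m / b + a ∧ m / b + 1 ≤ a * f + a := by
    rw [hc, mul_add]
    split_ifs <;> constructor <;> omega
  generalize m / b = d at key hm
  generalize m % b = e at hm hm'
  have h1 := Nat.mul_le_mul_left b key.1
  have h2 := Nat.mul_le_mul_left b key.2
  constructor <;> nlinarith

lemma sum_range_two_mul_sub (n c W : ℤ) (k : ℕ) :
    ∑ w ∈ range (k + 1), (2 * c * (n - w * c) + W) = (k + 1) * (c * (2 * n - c * k) + W) := by
  induction k with
  | zero => simp; ring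
  | succ k ih =>
    rw [sum_range_succ, ih]
    push_cast
    ring

lemma card_partsIn_triple {a b c : ℕ} (ha : 0 < a) (hb : 0 < b) (hc : 0 < c) (hab : a.Coprime b)
    (hne : b ≠ a) (hca : c ≠ a) (hcb : c ≠ b) (n : ℕ) :
    (n : ℤ) ^ 2 ≤ 2 * (a * b * c) * (#(partsIn {c, b, a} n) + (n + 1)) ∧
      2 * (a * b * c) * (#(partsIn {c, b, a} n) : ℤ) ≤ n ^ 2 + 2 * (a * b * c) * (2 * n + 1) := by
  have e := card_partsIn_insert (S := {b, a}) (by simp [ha.ne, hb.ne]) hc (by simp [hca, hcb]) n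
  have e' : 2 * (a * b * c) * (#(partsIn {c, b, a} n) : ℤ) =
      ∑ w ∈ range (n / c + 1), 2 * c * (a * b * (#(partsIn {b, a} (n - w * c)) : ℤ)) := by
    rw [e]
    push_cast
    rw [mul_sum]
    refine sum_congr rfl fun w _ => by ring
  have hw : ∀ w ∈ range (n / c + 1), ((n - w * c : ℕ) : ℤ) = n - w * c := fun w hw => by
    have : w * c ≤ n := (Nat.le_div_iff_mul_le hc).1 (by simpa [Nat.lt_succ_iff] using hw)
    push_cast [this]
    rfl
  have hup : 2 * (a * b * c) * (#(partsIn {c, b, a} n) : ℤ) ≤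
      ∑ w ∈ range (n / c + 1), (2 * c * ((n : ℤ) - w * c) + 2 * c * (a * b)) := by
    rw [e']
    refine sum_le_sum fun w h => ?_
    have := (card_partsIn_pair ha hb hab hne (n - w * c)).1
    zify at this
    rw [hw w h] at this
    rw [← mul_add]
    gcongr
  have hlo : ∑ w ∈ range (n / c + 1), (2 * c * ((n : ℤ) - w * c) + -(2 * c * (a * b))) ≤
      2 * (a * b * c) * (#(partsIn {c, b, a} n) : ℤ) := by
    rw [e']
    refine sum_le_sum fun w h => ?_
    have := (card_partsIn_pair ha hb hab hne (n - w * c)).2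
    zify at this
    rw [hw w h] at this
    rw [← mul_neg, ← mul_add]
    gcongr
    linarith
  rw [sum_range_two_mul_sub] at hup hlo
  have hd : (c : ℤ) * (n / c : ℕ) + (n % c : ℕ) = n := by exact_mod_cast Nat.div_add_mod n c
  have hr : ((n % c : ℕ) : ℤ) < c := by exact_mod_cast Nat.mod_lt n hc
  have hrn : ((n % c : ℕ) : ℤ) ≤ n := by exact_mod_cast Nat.mod_le n c
  have hr0 : (0 : ℤ) ≤ (n % c : ℕ) := by positivity
  generalize ((n / c : ℕ) : ℤ) = W at *
  generalize ((n % c : ℕ) : ℤ) = r at *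
  generalize (#(partsIn {c, b, a} n) : ℤ) = F at *
  have hP : (1 : ℤ) ≤ a * b := by exact_mod_cast Nat.mul_pos ha hb
  have hc1 : (1 : ℤ) ≤ c := by exact_mod_cast hc
  have hn0 : (0 : ℤ) ≤ n := by positivity
  generalize (a : ℤ) * b = P at *
  generalize (c : ℤ) = c at *
  generalize (n : ℤ) = n at *
  have e1 : (W + 1) * (c * (2 * n - c * W) + 2 * c * P) =
      (n + c - r) * (n + r) + 2 * P * (n + c - r) := by
    rw [← hd]; ring
  have e2 : (W + 1) * (c * (2 * n - c * W) + -(2 * c * P)) =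
      (n + c - r) * (n + r) - 2 * P * (n + c - r) := by
    rw [← hd]; ring
  rw [e1] at hup
  rw [e2] at hlo
  have hPn : 0 ≤ P * n := by positivity
  have hcn : 0 ≤ c * n := by positivity
  have hPr : 0 ≤ P * r := by positivity
  have h1 : c * n ≤ P * c * n := by nlinarith
  have h2 : P * n ≤ P * c * n := by nlinarith
  constructor
  · nlinarith [mul_nonneg hr0 (sub_nonneg.2 hr.le)]
  · nlinarith [mul_le_mul_of_nonneg_left hrn (by linarith : 0 ≤ c), mul_nonneg hr0 hr0]

lemma triple_difference_bound {p s k n : ℕ} (hp : 0 < p) (hs : 0 < s) (hk : s < k) {F G : ℕ → ℕ}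
    (hF : ∀ n : ℕ, (n : ℤ) ^ 2 ≤ 2 * (p * s) * (F n + (n + 1)))
    (hG : ∀ n : ℕ, 2 * (p * k) * (G n : ℤ) ≤ n ^ 2 + 2 * (p * k) * (2 * n + 1)) :
    (n : ℤ) ^ 2 ≤
      2 * p * s * (s + 1) * ((if s ≤ n then (F (n - s) : ℤ) else 0) - G n + (4 * n + 2)) := by
  have hg := hG n
  have hp' : (1 : ℤ) ≤ p := by exact_mod_cast hp
  have hs' : (1 : ℤ) ≤ s := by exact_mod_cast hs
  have hk' : (s : ℤ) + 1 ≤ k := by exact_mod_cast hk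
  have hn0 : (0 : ℤ) ≤ n := by positivity
  split_ifs with h
  · have hf := hF (n - s)
    rw [Nat.cast_sub h] at hf
    generalize (F (n - s) : ℤ) = f at *
    generalize (G n : ℤ) = g at *
    generalize (p : ℤ) = p at *
    generalize (s : ℤ) = s at *
    generalize (k : ℤ) = k at *
    generalize (n : ℤ) = n at *
    have hs0 : 0 ≤ s * (s + 1) := by nlinarith
    have h1 := mul_le_mul_of_nonneg_left hf (by nlinarith : 0 ≤ k * (s + 1))
    have h2 := mul_le_mul_of_nonneg_left hg (by nlinarith : 0 ≤ s * (s + 1))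
    have h3 : 0 ≤ s * (k - s - 1) * n ^ 2 :=
      mul_nonneg (mul_nonneg (by linarith) (by linarith)) (sq_nonneg n)
    have h4 : 0 ≤ (s * (s + 1)) * k * n * (p - 1) :=
      mul_nonneg (mul_nonneg (mul_nonneg hs0 (by linarith)) hn0) (by linarith)
    have h5 : 0 ≤ (s * (s + 1)) * k * (p * s) := by
      refine mul_nonneg (mul_nonneg hs0 (by linarith)) (by nlinarith)
    have h6 : 0 ≤ k * (s + 1) * s ^ 2 := mul_nonneg (by nlinarith) (sq_nonneg s)
    refine le_of_mul_le_mul_left ?_ (by linarith : 0 < k)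
    linarith
  · have hns : (n : ℤ) ≤ s := by exact_mod_cast (not_le.1 h).le
    generalize (G n : ℤ) = g at *
    generalize (p : ℤ) = p at *
    generalize (s : ℤ) = s at *
    generalize (k : ℤ) = k at *
    generalize (n : ℤ) = n at *
    have hpk : 0 < p * k := by nlinarith
    have h1 : n ^ 2 ≤ p * k * n := by nlinarith [mul_nonneg hn0 (by nlinarith : 0 ≤ p * k - n)]
    have h2 : 0 - g + (4 * n + 2) ≥ n + 1 := by nlinarith
    have h3 : s ≤ 2 * p * s * (s + 1) := by nlinarith [mul_nonneg (sub_nonneg.2 hp') (by nlinarith : 0 ≤ s * (s + 1))]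
    calc n ^ 2 ≤ s * (n + 1) := by nlinarith
      _ ≤ 2 * p * s * (s + 1) * (n + 1) := by gcongr
      _ ≤ _ := by gcongr

lemma sum_range_card_partsIn_le {R : Finset ℕ} (hR : 0 ∉ R) {n₀ K N : ℕ} (hN : n₀ + K ^ 3 < N) :
    ∑ u ∈ range n₀, (#(partsIn R (N - u)) : ℤ) ≤
      ∑ u ∈ Icc K N, (n₀ : ℤ) * u * #(partsIn R (N - u)) := by
  set f : ℕ → ℤ := fun u => (#(partsIn R (N - u)) : ℤ) with hf
  have hf0 : ∀ u, 0 ≤ f u := fun u => by positivity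
  have hterm : ∀ j ∈ range n₀, f j ≤ ∑ u ∈ Icc K N, u * f u := fun j hj => by
    have hj := mem_range.1 hj
    have h1 := card_partsIn_le_sum hR (K := K) (M := N - j) (by omega)
    zify at h1
    refine h1.trans ?_
    have h2 : ∑ t ∈ Icc K (N - j), (t : ℤ) * #(partsIn R (N - j - t)) ≤
        ∑ t ∈ Icc K (N - j), ((t + j : ℕ) : ℤ) * f (t + j) := by
      refine sum_le_sum fun t _ => ?_
      rw [hf, Nat.sub_sub, add_comm j t]
      gcongr
      omega
    refine h2.trans ?_
    have h3 := sum_map (Icc K (N - j)) (addRightEmbedding j) fun u => (u : ℤ) * f u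
    simp only [addRightEmbedding_apply, map_add_right_Icc] at h3
    rw [← h3]
    refine sum_le_sum_of_subset_of_nonneg (fun u hu => ?_) fun u _ _ =>
      mul_nonneg (by positivity) (hf0 u)
    rw [mem_Icc] at hu ⊢
    omega
  refine (sum_le_card_nsmul _ _ _ hterm).trans_eq ?_
  rw [card_range, nsmul_eq_mul, mul_sum]
  exact sum_congr rfl fun u _ => by ring

lemma convolution_pos (D : ℤ) (hD : 0 < D) : ∃ Γ : ℕ, ∀ (R : Finset ℕ) (h : ℕ → ℤ), 0 ∉ R →
    (∀ n : ℕ, (n : ℤ) ^ 2 ≤ D * (h n + (4 * n + 2))) → ∀ N ≥ Γ,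
    0 < ∑ u ∈ range (N + 1), (#(partsIn R (N - u)) : ℤ) * h u := by
  lift D to ℕ using hD.le
  obtain ⟨n₀, hn₀⟩ : ∃ n₀, n₀ = 4 * D + 1 := ⟨_, rfl⟩
  obtain ⟨C, hC⟩ : ∃ C, C = 4 * n₀ + 2 := ⟨_, rfl⟩
  obtain ⟨K, hK⟩ : ∃ K, K = D * C * n₀ + 7 * D + n₀ := ⟨_, rfl⟩
  refine ⟨n₀ + K ^ 3 + K + 1, fun R h hR hh N hN => ?_⟩
  have hD1 : (1 : ℤ) ≤ D := by omega
  have hlow : ∀ u : ℕ, u < n₀ → -(C : ℤ) ≤ h u := fun u hu => by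
    have : 0 ≤ h u + (4 * u + 2) := by
      by_contra! hneg
      nlinarith [hh u, sq_nonneg (u : ℤ)]
    omega
  have hmid : ∀ u : ℕ, n₀ ≤ u → 0 ≤ h u := fun u hu => by
    by_contra! hneg
    have hu' : 4 * (D : ℤ) + 1 ≤ u := by omega
    nlinarith [hh u]
  have hhigh : ∀ u : ℕ, K ≤ u → (C : ℤ) * n₀ * u + 1 ≤ h u := fun u hu => by
    by_contra! hneg
    have hu' : (D : ℤ) * (C * n₀) + 7 * D ≤ u := by
      have : D * C * n₀ + 7 * D ≤ u := by omega
      rw [mul_assoc] at this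
      exact_mod_cast this
    have hCn : (0 : ℤ) ≤ C * n₀ := by positivity
    generalize (C : ℤ) * n₀ = E at *
    have := hh u
    have hu0 : (1 : ℤ) ≤ u := by nlinarith
    have h1 : (D : ℤ) * (h u + (4 * u + 2)) ≤ D * (E * u + 4 * u + 2) := by
      gcongr ?_ * ?_
      linarith
    nlinarith
  set f : ℕ → ℤ := fun u => (#(partsIn R (N - u)) : ℤ) with hf
  have hf0 : ∀ u, 0 ≤ f u := fun u => by positivity
  have hsmall : ∑ u ∈ range n₀, f u ≤ ∑ u ∈ Icc K N, n₀ * u * f u :=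
    sum_range_card_partsIn_le hR (by omega)
  have hsplit : ∑ u ∈ range (N + 1), f u * h u =
      ∑ u ∈ range n₀, f u * h u + ∑ u ∈ Ico n₀ (N + 1), f u * h u :=
    (sum_range_add_sum_Ico _ (by omega)).symm
  have h1 : -(C : ℤ) * ∑ u ∈ range n₀, f u ≤ ∑ u ∈ range n₀, f u * h u := by
    rw [mul_sum]
    refine sum_le_sum fun u hu => ?_
    rw [mul_comm]
    exact mul_le_mul_of_nonneg_left (hlow u (mem_range.1 hu)) (hf0 u)
  have h2 : ∑ u ∈ Icc K N, f u * h u ≤ ∑ u ∈ Ico n₀ (N + 1), f u * h u := by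
    refine sum_le_sum_of_subset_of_nonneg (fun u hu => ?_) fun u hu _ =>
      mul_nonneg (hf0 u) (hmid u (mem_Ico.1 hu).1)
    rw [mem_Icc] at hu
    rw [mem_Ico]
    omega
  have h3 : ∑ u ∈ Icc K N, f u * (C * n₀ * u + 1) ≤ ∑ u ∈ Icc K N, f u * h u :=
    sum_le_sum fun u hu => mul_le_mul_of_nonneg_left (hhigh u (mem_Icc.1 hu).1) (hf0 u)
  have h4 : ∑ u ∈ Icc K N, f u * (C * n₀ * u + 1) =
      C * ∑ u ∈ Icc K N, n₀ * u * f u + ∑ u ∈ Icc K N, f u := by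
    rw [mul_sum, ← sum_add_distrib]
    exact sum_congr rfl fun u _ => by ring
  have h5 : 0 < ∑ u ∈ Icc K N, f u := by
    refine sum_pos' (fun u _ => hf0 u) ⟨N, mem_Icc.2 ⟨by omega, le_rfl⟩, ?_⟩
    simp [hf, card_partsIn_zero hR]
  have h6 := mul_le_mul_of_nonneg_left hsmall (by positivity : (0 : ℤ) ≤ C)
  linarith

lemma natCard_partition_eq {S : Finset ℕ} (hS : 0 ∉ S) (n : ℕ) (Q : Multiset ℕ → Prop)
    [DecidablePred Q] :
    Nat.card {p : n.Partition // Q p.parts ∧ ∀ x ∈ p.parts, x ∈ S} =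
      #((partsIn S n).filter Q) := by
  rw [Nat.card_eq_fintype_card, Fintype.card_subtype]
  refine card_bij (fun p _ => p.parts) (fun p hp => ?_) (fun p _ q _ h => Nat.Partition.ext h)
    (fun m hm => ?_)
  · simp only [mem_filter, mem_univ, true_and] at hp
    exact mem_filter.2 ⟨(mem_partsIn hS).2 ⟨p.parts_sum, hp.2⟩, hp.1⟩
  · simp only [partsIn, mem_filter, mem_image, mem_univ, true_and] at hm
    obtain ⟨⟨⟨p, rfl⟩, h⟩, hQ⟩ := hm
    exact ⟨p, by simpa using ⟨hQ, h⟩, rfl⟩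

lemma exists_pair_bounds {s k : ℕ} (hs : 0 < s) (hk : s < k) :
    ∃ x y : ℕ, s < x ∧ x < y ∧ y ≤ s + 3 ∧ x ≠ k ∧ y ≠ k ∧
      (∀ n : ℕ, (n : ℤ) ^ 2 ≤ 2 * ((x * y : ℕ) * s) * (#(partsIn {s, x, y} n) + (n + 1))) ∧
      ∀ n : ℕ, 2 * ((x * y : ℕ) * k) * (#(partsIn {k, x, y} n) : ℤ) ≤
        n ^ 2 + 2 * ((x * y : ℕ) * k) * (2 * n + 1) := by
  have hcop : ∀ a : ℕ, (a + 1).Coprime a := fun a => by simp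
  by_cases h2 : k = s + 2
  · subst h2
    refine ⟨s + 1, s + 3, by omega, by omega, by omega, by omega, by omega, fun n => ?_, fun n => ?_⟩
    · have := (card_partsIn_triple (a := s + 1) (b := s) (c := s + 3) (by omega) hs (by omega)
        (hcop s) (by omega) (by omega) (by omega) n).1
      have e : ({s, s + 1, s + 3} : Finset ℕ) = {s + 3, s, s + 1} := by
        ext
        simp only [mem_insert, mem_singleton]
        omega
      rw [e]
      convert this using 2
      push_cast
      ring
    · have := (card_partsIn_triple (a := s + 2) (b := s + 1) (c := s + 3) (by omega) (by omega)
        (by omega) (hcop (s + 1)) (by omega) (by omega) (by omega) n).2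
      have e : ({s + 2, s + 1, s + 3} : Finset ℕ) = {s + 3, s + 1, s + 2} := by
        ext
        simp only [mem_insert, mem_singleton]
        omega
      rw [e]
      convert this using 2 <;> push_cast <;> ring
  · obtain ⟨x, hx, hx2, hxk, hyk⟩ : ∃ x, s < x ∧ x ≤ s + 2 ∧ x ≠ k ∧ x + 1 ≠ k := by
      by_cases h1 : k = s + 1
      · exact ⟨s + 2, by omega⟩
      · exact ⟨s + 1, by omega⟩
    refine ⟨x, x + 1, hx, by omega, by omega, hxk, hyk, fun n => ?_, fun n => ?_⟩
    · have := (card_partsIn_triple (a := x + 1) (b := x) (c := s) (by omega) (by omega) hs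
        (hcop x) (by omega) (by omega) (by omega) n).1
      convert this using 2
      push_cast
      ring
    · have := (card_partsIn_triple (a := x + 1) (b := x) (c := k) (by omega) (by omega) (by omega)
        (hcop x) (by omega) (by omega) (by omega) n).2
      convert this using 2 <;> push_cast <;> ring

/-- For every positive integer `s` there exists a constant `Γ(s)`,
depending only on `s`, such that for all positive integers `L, k, N` with `L ≥ 3`,
`s + 1 ≤ k ≤ L + s` and `N ≥ Γ(s)`, the number of partitions of `N` in `I_{L,s,{k}}`
(smallest part equal to `s`, all parts `≤ L + s`, and `k` not a part) is strictly
greater than the number of partitions of `N` in `D_{L,s}` (nonempty partitions with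
all parts in `{s+1, …, L+s}`). -/
theorem berkovich_uncu_single_impermissible_part (s : ℕ) (hs : 0 < s) :
    ∃ Γ : ℕ, ∀ L k N : ℕ, 0 < L → 0 < k → 0 < N → 3 ≤ L →
      s + 1 ≤ k → k ≤ L + s → Γ ≤ N →
      Nat.card {p : N.Partition //
          s ∈ p.parts ∧ (∀ x ∈ p.parts, s ≤ x ∧ x ≤ L + s) ∧ k ∉ p.parts} >
      Nat.card {p : N.Partition //
          p.parts ≠ 0 ∧ ∀ x ∈ p.parts, s + 1 ≤ x ∧ x ≤ L + s} := by
  obtain ⟨Γ, hΓ⟩ := convolution_pos (2 * ((s + 3) * (s + 3) : ℕ) * s * (s + 1)) (by positivity)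
  refine ⟨Γ + s, fun L k N _ _ hN hL hsk hkL hΓN => ?_⟩
  obtain ⟨x, y, hx, hxy, hy, hxk, hyk, hF, hG⟩ := exists_pair_bounds hs hsk
  obtain ⟨M, rfl⟩ := Nat.exists_eq_add_of_le' (show s ≤ N by omega)
  set R : Finset ℕ := Icc (s + 1) (L + s) \ {k, x, y} with hR
  have hR0 : 0 ∉ R := by simp [hR]
  have hT : R ∪ {s, x, y} = (Icc s (L + s)).erase k := by
    ext z
    simp only [hR, mem_union, mem_sdiff, mem_Icc, mem_insert, mem_singleton, mem_erase]
    omega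
  have hU : R ∪ {k, x, y} = Icc (s + 1) (L + s) := by
    refine sdiff_union_of_subset fun z hz => ?_
    simp only [mem_insert, mem_singleton] at hz
    rw [mem_Icc]
    omega
  have hT0 : 0 ∉ (Icc s (L + s)).erase k := by simp [hs.ne']
  have hU0 : 0 ∉ Icc (s + 1) (L + s) := by simp
  have hI : Nat.card {p : (M + s).Partition //
      s ∈ p.parts ∧ (∀ x ∈ p.parts, s ≤ x ∧ x ≤ L + s) ∧ k ∉ p.parts} =
      #(partsIn ((Icc s (L + s)).erase k) M) := by
    rw [← card_filter_mem_partsIn hT0 (a := s) (by simp; omega), ← natCard_partition_eq hT0]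
    refine Nat.card_congr (Equiv.subtypeEquivRight fun p => and_congr_right fun _ => ?_)
    simp only [mem_erase, mem_Icc]
    exact ⟨fun h z hz => ⟨fun e => h.2 (e ▸ hz), h.1 z hz⟩,
      fun h => ⟨fun z hz => (h z hz).2, fun hk => (h k hk).1 rfl⟩⟩
  have hD : Nat.card {p : (M + s).Partition //
      p.parts ≠ 0 ∧ ∀ x ∈ p.parts, s + 1 ≤ x ∧ x ≤ L + s} ≤
      #(partsIn (Icc (s + 1) (L + s)) (M + s)) := by
    refine le_trans (le_of_eq ?_) (card_filter_le _ (· ≠ 0))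
    rw [← natCard_partition_eq hU0]
    simp only [mem_Icc]
  rw [hI]
  refine hD.trans_lt ?_
  have hpos := hΓ R (fun n => (if s ≤ n then (#(partsIn {s, x, y} (n - s)) : ℤ) else 0) -
    #(partsIn {k, x, y} n)) hR0 (fun n => ?_) (M + s) (by omega)
  · simp only [mul_sub, sum_sub_distrib] at hpos
    rw [← card_partsIn_union hR0 (by simp; omega) sdiff_disjoint, hU, add_right_comm, add_comm _ s,
      sum_range_add, sum_eq_zero, zero_add] at hpos
    · simp only [Nat.le_add_right, if_true, Nat.add_sub_cancel_left, add_comm M s,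
        Nat.add_sub_add_left] at hpos
      rw [← card_partsIn_union hR0 (by simp; omega), hT] at hpos
      · rw [add_comm M s]
        exact_mod_cast sub_pos.1 hpos
      · rw [disjoint_left]
        simp only [hR, mem_sdiff, mem_Icc, mem_insert, mem_singleton]
        omega
    · intro u hu
      rw [if_neg (by simpa using hu), mul_zero]
  · have h := triple_difference_bound (n := n) (Nat.mul_pos (by omega : 0 < x) (by omega : 0 < y))
      hs hsk hF hG
    have hp : 0 < x * y := Nat.mul_pos (by omega) (by omega)
    have hle : x * y ≤ (s + 3) * (s + 3) := Nat.mul_le_mul (by omega) hy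
    refine h.trans (mul_le_mul_of_nonneg_right ?_ ?_)
    · gcongr
    · refine nonneg_of_mul_nonneg_right ((sq_nonneg _).trans h) ?_
      positivity
end

section
/- Let L and s be positive integers and let V ⊆ {s+1, ..., L+s} be a nonempty set with t = |V| satisfying t ≤ (L-2)/2. Then for every integer N ≥ (10s)^5 · (t+1)^4 · (39 s^2 t^3)^{5t}, the number of partitions of N lying in I_{L,s,V} is at least the number of partitions of N lying in D_{L,s,V}. -/
/-- The multisets of positive integers with sum `n` that satisfy `Φ`. -/
noncomputable def partitionsWith (Φ : Multiset ℕ → Prop) (n : ℕ) : Finset (Multiset ℕ) := by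
  classical exact ((Finset.univ : Finset n.Partition).image Nat.Partition.parts).filter Φ

lemma mem_partitionsWith {Φ : Multiset ℕ → Prop} {n : ℕ} {m : Multiset ℕ} :
    m ∈ partitionsWith Φ n ↔ Φ m ∧ (∀ x ∈ m, 0 < x) ∧ m.sum = n := by
  classical
  simp only [partitionsWith, Finset.mem_filter, Finset.mem_image, Finset.mem_univ, true_and]
  constructor
  · rintro ⟨⟨p, rfl⟩, h⟩
    exact ⟨h, fun x hx => p.parts_pos hx, p.parts_sum⟩
  · rintro ⟨h, hp, hs⟩
    exact ⟨⟨⟨m, fun {x} hx => hp x hx, hs⟩, rfl⟩, h⟩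

lemma natCard_partition_subtype (Φ : Multiset ℕ → Prop) (n : ℕ) :
    Nat.card {p : n.Partition // Φ p.parts} = (partitionsWith Φ n).card := by
  classical
  rw [partitionsWith, Finset.filter_image, Finset.card_image_of_injective,
    Nat.card_eq_fintype_card, Fintype.card_subtype]
  intro p q h
  exact Nat.Partition.ext h

lemma card_partitionsWith_le_sum_antidiagonal {Φ Φ₁ Φ₂ : Multiset ℕ → Prop} (U : Finset ℕ)
    (h₁ : ∀ m, Φ m → Φ₁ (m.filter (· ∈ U))) (h₂ : ∀ m, Φ m → Φ₂ (m.filter (· ∉ U))) (n : ℕ) :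
    (partitionsWith Φ n).card ≤ ∑ ij ∈ Finset.HasAntidiagonal.antidiagonal n,
      (partitionsWith Φ₁ ij.1).card * (partitionsWith Φ₂ ij.2).card := by
  classical
  simp only [← Finset.card_product]
  rw [← Finset.card_sigma]
  refine Finset.card_le_card_of_injOn
    (fun m => ⟨((m.filter (· ∈ U)).sum, (m.filter (· ∉ U)).sum),
      (m.filter (· ∈ U), m.filter (· ∉ U))⟩) ?_ ?_
  · intro m hm
    obtain ⟨h, hp, hs⟩ := mem_partitionsWith.1 hm
    simp only [Finset.coe_sigma, Set.mem_sigma_iff, Finset.mem_coe,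
      Finset.HasAntidiagonal.mem_antidiagonal,
      Finset.mem_product, mem_partitionsWith]
    refine ⟨?_, ⟨h₁ m h, fun x hx => hp x (Multiset.mem_of_mem_filter hx), trivial⟩,
      h₂ m h, fun x hx => hp x (Multiset.mem_of_mem_filter hx), trivial⟩
    rw [← Multiset.sum_add, Multiset.filter_add_not, hs]
  · intro m _ m' _ h
    simp only [Sigma.mk.injEq, Prod.mk.injEq] at h
    have h' := eq_of_heq h.2
    rw [Prod.mk.injEq] at h'
    rw [← Multiset.filter_add_not (· ∈ U) m, ← Multiset.filter_add_not (· ∈ U) m', h'.1, h'.2]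

lemma sum_antidiagonal_le_card_partitionsWith {Φ Φ₁ Φ₂ : Multiset ℕ → Prop} (U : Finset ℕ)
    (h : ∀ x y, Φ₁ x → Φ₂ y → Φ (x + y)) (h₁ : ∀ m, Φ₁ m → ∀ x ∈ m, x ∈ U)
    (h₂ : ∀ m, Φ₂ m → ∀ x ∈ m, x ∉ U) (n : ℕ) :
    ∑ ij ∈ Finset.HasAntidiagonal.antidiagonal n,
      (partitionsWith Φ₁ ij.1).card * (partitionsWith Φ₂ ij.2).card ≤
      (partitionsWith Φ n).card := by
  classical
  simp only [← Finset.card_product]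
  rw [← Finset.card_sigma]
  refine Finset.card_le_card_of_injOn (fun z => z.2.1 + z.2.2) ?_ ?_
  · rintro ⟨⟨i, j⟩, x, y⟩ hz
    simp only [Finset.coe_sigma, Set.mem_sigma_iff, Finset.mem_coe,
      Finset.HasAntidiagonal.mem_antidiagonal,
      Finset.mem_product, mem_partitionsWith] at hz
    obtain ⟨hij, ⟨hx, hxp, hxs⟩, hy, hyp, hys⟩ := hz
    refine mem_partitionsWith.2 ⟨h x y hx hy, ?_, ?_⟩
    · intro z hz
      rcases Multiset.mem_add.1 hz with hz | hz
      exacts [hxp z hz, hyp z hz]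
    · rw [Multiset.sum_add, hxs, hys, hij]
  · rintro ⟨⟨i, j⟩, x, y⟩ hz ⟨⟨i', j'⟩, x', y'⟩ hz' he
    simp only [Finset.coe_sigma, Set.mem_sigma_iff, Finset.mem_coe,
      Finset.HasAntidiagonal.mem_antidiagonal,
      Finset.mem_product, mem_partitionsWith] at hz hz' he
    obtain ⟨-, ⟨hx, -, rfl⟩, hy, -, rfl⟩ := hz
    obtain ⟨-, ⟨hx', -, rfl⟩, hy', -, rfl⟩ := hz'
    have e1 : x = x' := by
      have := congrArg (Multiset.filter (· ∈ U)) he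
      rwa [Multiset.filter_add, Multiset.filter_add, Multiset.filter_eq_self.2 (h₁ x hx),
        Multiset.filter_eq_self.2 (h₁ x' hx'), Multiset.filter_eq_nil.2 (h₂ y hy),
        Multiset.filter_eq_nil.2 (h₂ y' hy'), add_zero, add_zero] at this
    subst e1
    have e2 : y = y' := add_left_cancel he
    subst e2
    rfl

/-- A multiset supported on `U` is determined by its multiplicities on `U`. -/
lemma multiset_ext_of_forall_mem {U : Finset ℕ} {m m' : Multiset ℕ} (h : ∀ x ∈ m, x ∈ U)
    (h' : ∀ x ∈ m', x ∈ U) (hc : ∀ x ∈ U, m.count x = m'.count x) : m = m' := by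
  ext x
  by_cases hx : x ∈ U
  · exact hc x hx
  · rw [Multiset.count_eq_zero_of_notMem fun hm => hx (h x hm),
      Multiset.count_eq_zero_of_notMem fun hm => hx (h' x hm)]

lemma multiset_sum_eq_sum_count {U : Finset ℕ} {m : Multiset ℕ} (h : ∀ x ∈ m, x ∈ U) :
    m.sum = ∑ x ∈ U, m.count x * x := by
  rw [Finset.sum_multiset_count_of_subset m U fun x hx => h x (Multiset.mem_toFinset.1 hx)]
  simp

/-- Partitions into two consecutive part sizes: upper bound. -/
lemma card_partitionsWith_pair_le (a : ℕ) (ha : 0 < a) (n : ℕ) :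
    (partitionsWith (fun m => ∀ x ∈ m, x ∈ ({a, a + 1} : Finset ℕ)) n).card ≤
      n / (a * (a + 1)) + 1 := by
  rw [← Finset.card_range (n / (a * (a + 1)) + 1)]
  have key : ∀ m ∈ partitionsWith (fun m => ∀ x ∈ m, x ∈ ({a, a + 1} : Finset ℕ)) n,
      m.count a * a + m.count (a + 1) * (a + 1) = n := by
    intro m hm
    obtain ⟨h, -, hs⟩ := mem_partitionsWith.1 hm
    rw [← hs, multiset_sum_eq_sum_count h, Finset.sum_pair (by omega)]
  refine Finset.card_le_card_of_injOn (fun m => m.count (a + 1) / a) ?_ ?_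
  · intro m hm
    have := key m hm
    simp only [Finset.coe_range, Set.mem_Iio, Nat.lt_succ_iff]
    rw [Nat.le_div_iff_mul_le (by positivity), ← mul_assoc]
    calc m.count (a + 1) / a * a * (a + 1) ≤ m.count (a + 1) * (a + 1) :=
          Nat.mul_le_mul_right _ (Nat.div_mul_le_self _ _)
      _ ≤ n := by omega
  · intro m hm m' hm' he
    have k := key m hm
    have k' := key m' hm'
    simp only at he
    have hmod : ∀ x y : ℕ, x * a + y * (a + 1) = n → y % a = n % a := by
      intro x y hxy
      rw [← hxy, show x * a + y * (a + 1) = y + (x + y) * a by ring, Nat.add_mul_mod_self_right]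
    have hb : m.count (a + 1) = m'.count (a + 1) := by
      rw [← Nat.div_add_mod (m.count (a + 1)) a, ← Nat.div_add_mod (m'.count (a + 1)) a, he,
        hmod _ _ k, hmod _ _ k']
    have hc : m.count a = m'.count a := by
      rw [hb] at k
      exact Nat.eq_of_mul_eq_mul_right ha (by omega)
    refine multiset_ext_of_forall_mem (mem_partitionsWith.1 hm).1 (mem_partitionsWith.1 hm').1 ?_
    intro x hx
    rcases Finset.mem_insert.1 hx with rfl | hx
    · exact hc
    · rw [Finset.mem_singleton.1 hx]; exact hb

/-- Partitions into two consecutive part sizes: lower bound. -/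
lemma le_card_partitionsWith_pair (a : ℕ) (ha : 0 < a) (n : ℕ) :
    n / (a * (a + 1)) ≤
      (partitionsWith (fun m => ∀ x ∈ m, x ∈ ({a, a + 1} : Finset ℕ)) n).card := by
  nth_rw 1 [← Finset.card_range (n / (a * (a + 1)))]
  have key : ∀ j < n / (a * (a + 1)), ∃ x, x * a + (n % a + a * j) * (a + 1) = n := by
    intro j hj
    have h1 : (j + 1) * (a * (a + 1)) ≤ n :=
      (Nat.mul_le_mul_right _ hj).trans (Nat.div_mul_le_self _ _)
    have h2 : n % a < a := Nat.mod_lt _ ha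
    have h3 : (n % a + a * j) * (a + 1) ≤ n := by nlinarith
    have h4 := Nat.div_add_mod n a
    obtain ⟨r, hr⟩ := Nat.exists_eq_add_of_le h3
    have h5 : a ∣ r := by
      have : (a : ℤ) ∣ r := by
        refine ⟨n / a - n % a - j * (a + 1), ?_⟩
        zify at hr h4
        linear_combination -h4 - hr
      exact_mod_cast this
    obtain ⟨x, rfl⟩ := h5
    exact ⟨x, by linarith⟩
  choose! f hf using key
  refine Finset.card_le_card_of_injOn
    (fun j => Multiset.replicate (f j) a + Multiset.replicate (n % a + a * j) (a + 1)) ?_ ?_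
  · intro j hj
    refine mem_partitionsWith.2 ⟨?_, ?_, ?_⟩
    · intro x hx
      rcases Multiset.mem_add.1 hx with hx | hx <;> simp [Multiset.eq_of_mem_replicate hx]
    · intro x hx
      rcases Multiset.mem_add.1 hx with hx | hx <;> simp [Multiset.eq_of_mem_replicate hx, ha]
    · simpa using hf j (by simpa using hj)
  · intro j _ j' _ he
    have := congrArg (Multiset.count (a + 1)) he
    simp only [Multiset.count_add, Multiset.count_replicate] at this
    simp at this
    omega

/-- Trading parts: a large partition has some part `b` with at least `⌈T / b⌉` copies. -/
lemma card_partitionsWith_le_sum_sub (A : Finset ℕ) (hA : ∀ b ∈ A, 0 < b) (T w : ℕ) (hT : 0 < T)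
    (hw : T ^ 2 ≤ w) :
    (partitionsWith (fun m => ∀ x ∈ m, x ∈ A) w).card ≤
      ∑ b ∈ A, if (T ⌈/⌉ b) * b ≤ w then
        (partitionsWith (fun m => ∀ x ∈ m, x ∈ A) (w - (T ⌈/⌉ b) * b)).card else 0 := by
  classical
  have hcov : partitionsWith (fun m => ∀ x ∈ m, x ∈ A) w ⊆
      A.biUnion fun b => (partitionsWith (fun m => ∀ x ∈ m, x ∈ A) w).filter
        fun m => T ⌈/⌉ b ≤ m.count b := by
    intro m hm
    obtain ⟨h, hp, hs⟩ := mem_partitionsWith.1 hm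
    simp only [Finset.mem_biUnion, Finset.mem_filter]
    by_contra! hcon
    have hlt : ∀ b ∈ A, m.count b * b < T := by
      intro b hb
      have := hcon b hb hm
      by_contra! hc
      have hle : T ⌈/⌉ b ≤ m.count b :=
        (ceilDiv_le_iff_le_mul (hA b hb)).2 (by rwa [mul_comm])
      omega
    have hsub : ∑ b ∈ A, m.count b * b ≤ ∑ b ∈ (Finset.range T).erase 0, (T - 1) := by
      rw [← Finset.sum_filter_add_sum_filter_not A (· < T)]
      rw [show ∑ b ∈ A with ¬ b < T, m.count b * b = 0 from ?_, add_zero]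
      · refine (Finset.sum_le_sum fun b hb => ?_).trans
          (Finset.sum_le_sum_of_subset (f := fun _ => T - 1) ?_)
        · have := hlt b (Finset.mem_filter.1 hb).1
          omega
        · intro b hb
          have := hA b (Finset.mem_filter.1 hb).1
          simp only [Finset.mem_filter] at hb
          simp only [Finset.mem_erase, Finset.mem_range]
          omega
      · refine Finset.sum_eq_zero fun b hb => ?_
        simp only [Finset.mem_filter, not_lt] at hb
        have := hlt b hb.1
        rcases Nat.eq_zero_or_pos (m.count b) with h0 | h0
        · simp [h0]
        · nlinarith
    rw [← multiset_sum_eq_sum_count h, hs, Finset.sum_const, Finset.card_erase_of_mem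
      (by simpa using hT), Finset.card_range, smul_eq_mul] at hsub
    obtain ⟨T, rfl⟩ := Nat.exists_eq_add_of_lt hT
    simp only [zero_add, Nat.add_sub_cancel] at *
    nlinarith
  refine (Finset.card_le_card hcov).trans (Finset.card_biUnion_le.trans ?_)
  refine Finset.sum_le_sum fun b hb => ?_
  have hsum : ∀ m : Multiset ℕ, T ⌈/⌉ b ≤ m.count b →
      Multiset.replicate (T ⌈/⌉ b) b + (m - Multiset.replicate (T ⌈/⌉ b) b) = m := by
    intro m hm
    exact add_tsub_cancel_of_le (Multiset.le_count_iff_replicate_le.1 hm)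
  split_ifs with hbw
  · refine Finset.card_le_card_of_injOn (fun m => m - Multiset.replicate (T ⌈/⌉ b) b) ?_ ?_
    · intro m hm
      obtain ⟨hm, hc⟩ := Finset.mem_filter.1 hm
      obtain ⟨h, hp, hs⟩ := mem_partitionsWith.1 hm
      have hle : m - Multiset.replicate (T ⌈/⌉ b) b ≤ m := Multiset.sub_le_self _ _
      refine mem_partitionsWith.2 ⟨fun x hx => h x (Multiset.mem_of_le hle hx),
        fun x hx => hp x (Multiset.mem_of_le hle hx), ?_⟩
      have := congrArg Multiset.sum (hsum m hc)
      simp only [Multiset.sum_add, Multiset.sum_replicate, smul_eq_mul] at this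
      simp only
      omega
    · intro m hm m' hm' he
      simp only at he
      rw [← hsum m (Finset.mem_filter.1 hm).2, ← hsum m' (Finset.mem_filter.1 hm').2, he]
  · rw [Nat.le_zero, Finset.card_eq_zero, Finset.filter_eq_empty_iff]
    intro m hm hc
    obtain ⟨h, hp, hs⟩ := mem_partitionsWith.1 hm
    have := congrArg Multiset.sum (hsum m hc)
    simp only [Multiset.sum_add, Multiset.sum_replicate, smul_eq_mul] at this
    omega

/-- Multisets supported on `V` all of whose multiplicities on `V` are `t`-th powers. -/
def IsPowerSupported (V : Finset ℕ) (t : ℕ) (m : Multiset ℕ) : Prop :=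
  (∀ x ∈ m, x ∈ V) ∧ ∀ k ∈ V, ∃ r : ℕ, m.count k = r ^ t

lemma sum_card_isPowerSupported_le (V : Finset ℕ) (t s j v : ℕ) (hcard : V.card = t)
    (hV : ∀ k ∈ V, s + 1 ≤ k) (hv : ∀ r, (s + 1) * r ^ t ≤ j → r ≤ v) :
    ∑ i ∈ Finset.range (j + 1), (partitionsWith (IsPowerSupported V t) i).card ≤ (v + 1) ^ t := by
  classical
  have hroot : ∀ m, IsPowerSupported V t m → ∀ k ∈ V,
      Function.invFun (fun r : ℕ => r ^ t) (m.count k) ^ t = m.count k := by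
    intro m hm k hk
    obtain ⟨r, hr⟩ := hm.2 k hk
    exact Function.invFun_eq (f := fun r : ℕ => r ^ t) ⟨r, hr.symm⟩
  rw [← Finset.card_sigma]
  calc _ ≤ (V.pi fun _ => Finset.range (v + 1)).card := ?_
    _ = (v + 1) ^ t := by rw [Finset.card_pi, Finset.prod_const, Finset.card_range, hcard]
  refine Finset.card_le_card_of_injOn
    (fun z k _ => Function.invFun (fun r : ℕ => r ^ t) (z.2.count k)) ?_ ?_
  · rintro ⟨i, m⟩ hz
    simp only [Finset.coe_sigma, Set.mem_sigma_iff, Finset.mem_coe, Finset.mem_range,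
      mem_partitionsWith] at hz
    obtain ⟨hi, hm, -, hs⟩ := hz
    simp only [Finset.mem_coe, Finset.mem_pi, Finset.mem_range, Nat.lt_succ_iff]
    intro k hk
    refine hv _ ?_
    rw [hroot m hm k hk]
    have h1 : m.count k * k ≤ m.sum := by
      rw [multiset_sum_eq_sum_count hm.1]
      exact Finset.single_le_sum (f := fun x => m.count x * x) (fun _ _ => Nat.zero_le _) hk
    have h2 := Nat.mul_le_mul_right (m.count k) (hV k hk)
    rw [mul_comm k] at h2
    omega
  · rintro ⟨i, m⟩ hz ⟨i', m'⟩ hz' he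
    simp only [Finset.coe_sigma, Set.mem_sigma_iff, Finset.mem_coe, Finset.mem_range,
      mem_partitionsWith] at hz hz'
    obtain ⟨-, hm, -, rfl⟩ := hz
    obtain ⟨-, hm', -, rfl⟩ := hz'
    have : m = m' := by
      refine multiset_ext_of_forall_mem hm.1 hm'.1 fun k hk => ?_
      rw [← hroot m hm k hk, ← hroot m' hm' k hk]
      exact congrArg (· ^ t) (congrFun (congrFun he k) hk)
    subst this
    rfl

lemma succ_pow_mul_le (s t v : ℕ) :
    (2 * s + 1) * (v + 1) ^ t ≤ (2 * s + 2) * v ^ t + (2 * s + 1) * ((2 * s + 2) * t) ^ t := by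
  rcases le_or_gt (v + 1) ((2 * s + 2) * t) with h | h
  · have := Nat.mul_le_mul_left (2 * s + 1) (Nat.pow_le_pow_left h t)
    omega
  · have hb := one_add_mul_le_pow (a := (-1 / ((v : ℚ) + 1))) (by
      rw [le_div_iff₀ (by positivity)]; linarith [(Nat.cast_nonneg v : (0 : ℚ) ≤ v)]) t
    have hv : (0 : ℚ) < (v : ℚ) + 1 := by positivity
    have e : (1 : ℚ) + -1 / ((v : ℚ) + 1) = v / (v + 1) := by field_simp; ring
    rw [e, div_pow] at hb
    have h' : ((2 * s + 2) * t : ℚ) ≤ (v : ℚ) + 1 := by exact_mod_cast h.le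
    have h1 : (2 * s + 1 : ℚ) / (2 * s + 2) ≤ 1 + t * (-1 / ((v : ℚ) + 1)) := by
      rw [div_le_iff₀ (by positivity)]
      have : (t : ℚ) * (2 * s + 2) / (v + 1) ≤ 1 := by
        rw [div_le_one hv]; linarith
      have e2 : (1 + t * (-1 / ((v : ℚ) + 1))) * (2 * s + 2) =
        (2 * s + 2) - (t : ℚ) * (2 * s + 2) / (v + 1) := by field_simp; ring
      rw [e2]; linarith
    have h2 := h1.trans hb
    rw [div_le_div_iff₀ (by positivity) (by positivity)] at h2
    have h3 : (2 * s + 1) * (v + 1) ^ t ≤ v ^ t * (2 * s + 2) := by exact_mod_cast h2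
    calc _ ≤ _ := h3
      _ ≤ _ := by rw [mul_comm]; exact Nat.le_add_right _ _

lemma mul_sum_card_isPowerSupported_le (V : Finset ℕ) (t s j : ℕ) (ht : 0 < t) (hcard : V.card = t)
    (hV : ∀ k ∈ V, s + 1 ≤ k) :
    (2 * s + 1) * ∑ i ∈ Finset.range (j + 1), (partitionsWith (IsPowerSupported V t) i).card ≤
      2 * j + (2 * s + 1) * ((2 * s + 2) * t) ^ t := by
  set v := Nat.findGreatest (fun v => (s + 1) * v ^ t ≤ j) j with hvdef
  have hv0 : (s + 1) * v ^ t ≤ j :=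
    Nat.findGreatest_spec (P := fun v => (s + 1) * v ^ t ≤ j) (Nat.zero_le j)
      (by simp [ht.ne'])
  have hv : ∀ r, (s + 1) * r ^ t ≤ j → r ≤ v := by
    intro r hr
    refine Nat.le_findGreatest ?_ hr
    have := Nat.le_self_pow ht.ne' r
    nlinarith [Nat.zero_le (s * r ^ t)]
  have h1 := sum_card_isPowerSupported_le V t s j v hcard hV hv
  have h2 := succ_pow_mul_le s t v
  have h3 := Nat.mul_le_mul_left (2 * s + 1) h1
  nlinarith

lemma sum_mul_sub_eq_sum_partial_sums (r : ℕ → ℤ) (M : ℕ) :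
    ∑ i ∈ Finset.range (M + 1), r i * ((M : ℤ) - i) =
      ∑ j ∈ Finset.range M, ∑ i ∈ Finset.range (j + 1), r i := by
  induction M with
  | zero => simp
  | succ M ih =>
    rw [Finset.sum_range_succ, Finset.sum_range_succ (fun j => ∑ i ∈ Finset.range (j + 1), r i) M,
      ← ih, ← Finset.sum_add_distrib]
    simp only [sub_self, mul_zero, add_zero]
    refine Finset.sum_congr rfl fun i _ => ?_
    push_cast
    ring

/-- Upper bound for a convolution, given linear bounds on the partial sums of one factor and
pointwise linear bounds on the other. -/
lemma convolution_le (r p : ℕ → ℕ) (s c E M : ℕ)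
    (hr : ∀ j, (2 * s + 1) * ∑ i ∈ Finset.range (j + 1), r i ≤ 2 * j + (2 * s + 1) * E)
    (hp : ∀ n, c * p n ≤ n + c) :
    ((2 * s + 1) * c * ∑ ij ∈ Finset.HasAntidiagonal.antidiagonal M, (r ij.1 * p ij.2 : ℤ)) ≤
      M ^ 2 + (2 * s + 1) * E * M + 2 * c * M + c * (2 * s + 1) * E := by
  rw [Finset.Nat.sum_antidiagonal_eq_sum_range_succ (fun i j => (r i * p j : ℤ))]
  have h1 : (c * ∑ i ∈ Finset.range (M + 1), (r i * p (M - i) : ℤ)) ≤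
      (∑ j ∈ Finset.range M, ∑ i ∈ Finset.range (j + 1), (r i : ℤ)) +
        c * ∑ i ∈ Finset.range (M + 1), (r i : ℤ) := by
    rw [← sum_mul_sub_eq_sum_partial_sums, Finset.mul_sum, Finset.mul_sum,
      ← Finset.sum_add_distrib]
    refine Finset.sum_le_sum fun i hi => ?_
    have hi' : i ≤ M := Nat.lt_succ_iff.1 (Finset.mem_range.1 hi)
    have := hp (M - i)
    zify [hi'] at this
    nlinarith [mul_le_mul_of_nonneg_left this (Nat.cast_nonneg (r i) : (0 : ℤ) ≤ r i)]
  have hr' : ∀ j : ℕ, ((2 * s + 1) * ∑ i ∈ Finset.range (j + 1), (r i : ℤ)) ≤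
      2 * j + (2 * s + 1) * E := fun j => by exact_mod_cast hr j
  have h2 : (2 * s + 1 : ℤ) * ∑ j ∈ Finset.range M, ∑ i ∈ Finset.range (j + 1), (r i : ℤ) ≤
      M ^ 2 + (2 * s + 1) * E * M := by
    rw [Finset.mul_sum]
    have hsum : ∀ M : ℕ, ∑ j ∈ Finset.range M, (2 * (j : ℤ) + (2 * s + 1) * E) ≤
        M ^ 2 + (2 * s + 1) * E * M := by
      intro M
      induction M with
      | zero => simp
      | succ M ih =>
        rw [Finset.sum_range_succ]
        push_cast
        nlinarith
    exact (Finset.sum_le_sum fun j _ => hr' j).trans (hsum M)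
  have h3 := mul_le_mul_of_nonneg_left (hr' M) (Nat.cast_nonneg c : (0 : ℤ) ≤ c)
  have h4 := mul_le_mul_of_nonneg_left h1 (by positivity : (0 : ℤ) ≤ 2 * s + 1)
  nlinarith

/-- Lower bound for a convolution with the indicator of the positive multiples of `s`. -/
lemma le_convolution (σ p : ℕ → ℕ) (s c M : ℕ) (hs : 0 < s) (hσ : ∀ i, 0 < i → 1 ≤ σ (s * i))
    (hp : ∀ n, n ≤ c * p n + c) :
    (M ^ 2 - s * M - 2 * c * M : ℤ) ≤
      2 * s * c * ∑ ij ∈ Finset.HasAntidiagonal.antidiagonal M, (σ ij.1 * p ij.2 : ℤ) := by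
  set q := M / s with hq
  have hqM : s * q ≤ M := Nat.mul_div_le M s
  have h1 : ∑ i ∈ Finset.range q, (p (M - s * (i + 1)) : ℤ) ≤
      ∑ ij ∈ Finset.HasAntidiagonal.antidiagonal M, (σ ij.1 * p ij.2 : ℤ) := by
    have himg : (Finset.range q).image (fun i => (s * (i + 1), M - s * (i + 1))) ⊆
        Finset.HasAntidiagonal.antidiagonal M := by
      intro ij hij
      obtain ⟨i, hi, rfl⟩ := Finset.mem_image.1 hij
      have : s * (i + 1) ≤ s * q := Nat.mul_le_mul_left _ (Finset.mem_range.1 hi)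
      rw [Finset.HasAntidiagonal.mem_antidiagonal]
      simp only
      omega
    refine le_trans ?_ (Finset.sum_le_sum_of_subset_of_nonneg himg fun _ _ _ => by positivity)
    rw [Finset.sum_image]
    · refine Finset.sum_le_sum fun i _ => ?_
      have : (1 : ℤ) ≤ σ (s * (i + 1)) := by exact_mod_cast hσ (i + 1) (Nat.succ_pos i)
      nlinarith [(Nat.cast_nonneg (p (M - s * (i + 1))) : (0 : ℤ) ≤ _)]
    · intro i _ j _ hij
      simp only [Prod.mk.injEq] at hij
      have := Nat.eq_of_mul_eq_mul_left hs hij.1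
      omega
  have h2 : ∀ q : ℕ, s * q ≤ M → (2 * q * M - s * q * (q + 1) - 2 * c * q : ℤ) ≤
      2 * c * ∑ i ∈ Finset.range q, (p (M - s * (i + 1)) : ℤ) := by
    intro q
    induction q with
    | zero => simp
    | succ q ih =>
      intro hle
      have hle' : s * q ≤ M := (Nat.mul_le_mul_left _ (Nat.le_succ q)).trans hle
      have := hp (M - s * (q + 1))
      zify [hle] at this
      rw [Finset.sum_range_succ]
      push_cast
      nlinarith [ih hle']
  have h3 := h2 q hqM
  obtain ⟨ρ, hρ⟩ : ∃ ρ, ρ = M % s := ⟨_, rfl⟩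
  have hdm : (M : ℤ) = s * q + ρ := by
    rw [hρ, hq]; exact_mod_cast (Nat.div_add_mod M s).symm
  have hρs : (ρ : ℤ) ≤ s := by rw [hρ]; exact_mod_cast (Nat.mod_lt M hs).le
  have h4 := mul_le_mul_of_nonneg_left h1 (by positivity : (0 : ℤ) ≤ 2 * s * c)
  have h5 := mul_le_mul_of_nonneg_left h3 (Nat.cast_nonneg s : (0 : ℤ) ≤ s)
  refine le_trans ?_ h4
  refine le_trans ?_ (h5.trans_eq (by ring))
  have h6 : (0 : ℤ) ≤ ρ * (s - ρ) := mul_nonneg (by positivity) (by linarith)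
  have h7 : (c : ℤ) * (s * q) ≤ c * M :=
    mul_le_mul_of_nonneg_left (by exact_mod_cast hqM) (by positivity)
  have h8 : (s * (2 * q * M - s * q * (q + 1) - 2 * c * q) : ℤ) =
      M ^ 2 - s * M + ρ * (s - ρ) - 2 * (c * (s * q)) := by
    rw [hdm]; ring
  rw [h8]
  linarith

/-- If the mass of `Q` on `(N - A, N]` is at most `B` times its mass on `[0, N - T]`, the
convolution of `Q` with `F` is nonnegative as soon as `F` is nonnegative from `A` on, at least
`-C` everywhere and at least `B * C` from `T` on. -/
lemma sum_mul_nonneg_of_window (Q : ℕ → ℕ) (F : ℕ → ℤ) (N A T B C : ℕ) (hAT : A ≤ T)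
    (hF : ∀ M, -(C : ℤ) ≤ F M) (hFA : ∀ M, A ≤ M → 0 ≤ F M) (hFT : ∀ M, T ≤ M → (B * C : ℤ) ≤ F M)
    (hQ : ∑ w ∈ (Finset.range (N + 1)).filter (fun w => N < w + A), Q w ≤
      B * ∑ w ∈ (Finset.range (N + 1)).filter (fun w => w + T ≤ N), Q w) :
    0 ≤ ∑ w ∈ Finset.range (N + 1), (Q w : ℤ) * F (N - w) := by
  have h1 : ∑ w ∈ Finset.range (N + 1), ((if w + T ≤ N then (Q w : ℤ) * (B * C) else 0) -
      (if N < w + A then (Q w : ℤ) * C else 0)) ≤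
      ∑ w ∈ Finset.range (N + 1), (Q w : ℤ) * F (N - w) := by
    refine Finset.sum_le_sum fun w hw => ?_
    have hQ0 : (0 : ℤ) ≤ Q w := Nat.cast_nonneg _
    split_ifs with h h' h'
    · omega
    · have := mul_le_mul_of_nonneg_left (hFT (N - w) (by omega)) hQ0
      linarith
    · have := mul_le_mul_of_nonneg_left (hF (N - w)) hQ0
      linarith
    · have := mul_nonneg hQ0 (hFA (N - w) (by omega))
      linarith
  refine le_trans ?_ h1
  rw [Finset.sum_sub_distrib, ← Finset.sum_filter, ← Finset.sum_filter, ← Finset.sum_mul,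
    ← Finset.sum_mul]
  have h2 := Nat.mul_le_mul_right C hQ
  have h3 : ((∑ w ∈ (Finset.range (N + 1)).filter (fun w => N < w + A), (Q w : ℤ)) * C) ≤
      B * (∑ w ∈ (Finset.range (N + 1)).filter (fun w => w + T ≤ N), (Q w : ℤ)) * C := by
    exact_mod_cast h2
  linarith

lemma sum_window_card_partitionsWith_le (A : Finset ℕ) (hA : ∀ b ∈ A, 0 < b) (T D N : ℕ)
    (hT : 0 < T) (hN : T ^ 2 + D ≤ N) :
    ∑ w ∈ (Finset.range (N + 1)).filter (fun w => N < w + D),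
        (partitionsWith (fun m => ∀ x ∈ m, x ∈ A) w).card ≤
      (T + D) * ∑ w ∈ (Finset.range (N + 1)).filter (fun w => w + T ≤ N),
        (partitionsWith (fun m => ∀ x ∈ m, x ∈ A) w).card := by
  classical
  set Q : ℕ → ℕ := fun w => (partitionsWith (fun m => ∀ x ∈ m, x ∈ A) w).card with hQdef
  set W := (Finset.range (N + 1)).filter (fun w => N < w + D) with hW
  set S := ∑ w ∈ (Finset.range (N + 1)).filter (fun w => w + T ≤ N), Q w with hS
  have hc : ∀ b ∈ A, T ≤ (T ⌈/⌉ b) * b := fun b hb => by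
    rw [mul_comm]; exact (ceilDiv_le_iff_le_mul (hA b hb)).1 le_rfl
  have inj_le : ∀ (ι : Type) (X : Finset ι) (g : ι → ℕ) (P : ι → Prop) [DecidablePred P],
      (∀ x ∈ X, P x → g x + T ≤ N) → (∀ x ∈ X, ∀ y ∈ X, P x → P y → g x = g y → x = y) →
      ∑ x ∈ X, (if P x then Q (g x) else 0) ≤ S := by
    intro ι X g P _ h1 h2
    rw [← Finset.sum_filter, ← Finset.sum_image (f := Q) (g := g) (s := X.filter P)]
    · refine Finset.sum_le_sum_of_subset fun y hy => ?_
      obtain ⟨x, hx, rfl⟩ := Finset.mem_image.1 hy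
      obtain ⟨hx, hP⟩ := Finset.mem_filter.1 hx
      have := h1 x hx hP
      simp only [Finset.mem_filter, Finset.mem_range]
      omega
    · intro x hx y hy hxy
      simp only [Finset.coe_filter, Set.mem_ofPred_eq] at hx hy
      exact h2 x hx.1 y hy.1 hx.2 hy.2 hxy
  have hWle : ∀ w ∈ W, w ≤ N ∧ N < w + D := fun w hw => by
    simp only [hW, Finset.mem_filter, Finset.mem_range] at hw
    omega
  have step : ∀ w ∈ W, Q w ≤ ∑ b ∈ A, if (T ⌈/⌉ b) * b ≤ w then Q (w - (T ⌈/⌉ b) * b) else 0 :=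
    fun w hw => card_partitionsWith_le_sum_sub A hA T w hT (by have := hWle w hw; omega)
  refine (Finset.sum_le_sum step).trans ?_
  simp_rw [← Finset.sum_filter_add_sum_filter_not A (· < T)]
  rw [Finset.sum_add_distrib, add_mul, Finset.sum_comm]
  refine add_le_add ?_ ?_
  · calc _ ≤ ∑ b ∈ A.filter (· < T), S := ?_
      _ ≤ T * S := ?_
    · refine Finset.sum_le_sum fun b hb => ?_
      have hb' := hc b (Finset.mem_filter.1 hb).1
      refine inj_le ℕ W (fun w => w - (T ⌈/⌉ b) * b) (fun w => (T ⌈/⌉ b) * b ≤ w) ?_ ?_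
      · intro w hw h
        have := hWle w hw
        omega
      · intro w _ w' _ h h' e
        omega
    · rw [Finset.sum_const, smul_eq_mul]
      refine Nat.mul_le_mul_right _ ?_
      calc _ ≤ (Finset.range T).card := Finset.card_le_card fun b hb => by
            simpa using (Finset.mem_filter.1 hb).2
        _ = T := Finset.card_range T
  · calc _ ≤ ∑ w ∈ W, S := ?_
      _ ≤ D * S := ?_
    · refine Finset.sum_le_sum fun w hw => ?_
      have hceil : ∀ b ∈ A.filter (fun b => ¬ b < T), T ⌈/⌉ b = 1 := by
        intro b hb
        obtain ⟨hb, hbT⟩ := Finset.mem_filter.1 hb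
        have h1 : T ⌈/⌉ b ≤ 1 := (ceilDiv_le_iff_le_mul (hA b hb)).2 (by omega)
        have h2 := hc b hb
        rcases Nat.eq_zero_or_pos (T ⌈/⌉ b) with h0 | h0
        · rw [h0] at h2; omega
        · omega
      refine inj_le ℕ _ (fun b => w - (T ⌈/⌉ b) * b) (fun b => (T ⌈/⌉ b) * b ≤ w) ?_ ?_
      · intro b hb h
        have := hWle w hw
        have := hc b (Finset.mem_filter.1 hb).1
        omega
      · intro b hb b' hb' h h' e
        simp only [hceil b hb, hceil b' hb', one_mul] at h h' e
        omega
    · rw [Finset.sum_const, smul_eq_mul]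
      refine Nat.mul_le_mul_right _ ?_
      calc _ ≤ (Finset.Ioc (N - D) N).card := Finset.card_le_card fun w hw => by
            have := hWle w hw
            simp only [Finset.mem_Ioc]
            omega
        _ ≤ D := by rw [Nat.card_Ioc]; omega

lemma exists_consecutive_notMem (V : Finset ℕ) (s : ℕ) :
    ∃ a, s + 1 ≤ a ∧ a + 1 ≤ s + 2 * V.card + 2 ∧ a ∉ V ∧ a + 1 ∉ V := by
  classical
  by_contra! hcon
  have h : ∀ i ∈ Finset.range (V.card + 1), ∃ x ∈ V, x = s + 1 + 2 * i ∨ x = s + 2 + 2 * i := by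
    intro i hi
    have hi := Finset.mem_range.1 hi
    by_cases h1 : s + 1 + 2 * i ∈ V
    · exact ⟨_, h1, Or.inl rfl⟩
    · exact ⟨_, hcon (s + 1 + 2 * i) (by omega) (by omega) h1, Or.inr (by omega)⟩
  choose! g hgV hg using h
  have := Finset.card_le_card_of_injOn (s := Finset.range (V.card + 1)) (t := V) g
    (fun i hi => hgV i hi) (fun i hi j hj hij => by
      have h1 := hg i hi
      have h2 := hg j hj
      omega)
  rw [Finset.card_range] at this
  omega

lemma threshold_bound (s t a N : ℕ) (hs : 0 < s) (ht : 0 < t) (ha : a + 1 ≤ s + 2 * t + 2)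
    (hN : (10 * s) ^ 5 * (t + 1) ^ 4 * (39 * s ^ 2 * t ^ 3) ^ (5 * t) ≤ N) :
    17 * (s * (2 * s + 1) * (1 + 2 * ((2 * s + 2) * t) ^ t) +
      2 * (a * (a + 1)) * (4 * s + 1)) ^ 4 ≤ N := by
  have hst : 1 ≤ s * t := Nat.mul_pos hs ht
  have hs_le : s ≤ s * t := Nat.le_mul_of_pos_right s ht
  have ht_le : t ≤ s * t := Nat.le_mul_of_pos_left t hs
  set X := (4 * s * t) ^ t with hX
  have hE : ((2 * s + 2) * t) ^ t ≤ X := by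
    refine Nat.pow_le_pow_left ?_ t
    exact Nat.mul_le_mul_right t (by omega)
  have hX4 : 4 * (s * t) ≤ X := by
    rw [← mul_assoc]; exact Nat.le_self_pow ht.ne' _
  have hc : a * (a + 1) ≤ 20 * (s * t) ^ 2 := by
    calc a * (a + 1) ≤ (4 * (s * t)) * (5 * (s * t)) := Nat.mul_le_mul (by omega) (by omega)
      _ = _ := by ring
  have hK : s * (2 * s + 1) * (1 + 2 * ((2 * s + 2) * t) ^ t) +
      2 * (a * (a + 1)) * (4 * s + 1) ≤ 59 * (s ^ 2 * t * X) := by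
    have h1 : s * (2 * s + 1) ≤ 3 * s ^ 2 := by nlinarith
    have h2 : 1 + 2 * ((2 * s + 2) * t) ^ t ≤ 3 * (t * X) := by
      have : X ≤ t * X := Nat.le_mul_of_pos_left X ht
      omega
    have h3 : 2 * (a * (a + 1)) * (4 * s + 1) ≤ 2 * (20 * (s * t) ^ 2) * (5 * s) :=
      Nat.mul_le_mul (by omega) (by omega)
    have h4 : 2 * (20 * (s * t) ^ 2) * (5 * s) ≤ 50 * (s ^ 2 * t * X) := by
      calc 2 * (20 * (s * t) ^ 2) * (5 * s) = 50 * (s ^ 2 * t * (4 * (s * t))) := by ring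
        _ ≤ _ := by gcongr
    have h5 := Nat.mul_le_mul h1 h2
    nlinarith
  refine le_trans ?_ hN
  calc _ ≤ 17 * (59 * (s ^ 2 * t * X)) ^ 4 := by gcongr
    _ = 205995137 * s ^ 8 * t ^ 4 * X ^ 4 := by ring
    _ ≤ 25587900000 * s ^ 11 * t ^ 11 * X ^ 4 := by
        gcongr <;> norm_num
    _ = (10 * s) ^ 5 * 1 ^ 4 * ((9 * s * t ^ 2) ^ 4 * X ^ 4 * (39 * s ^ 2 * t ^ 3)) := by ring
    _ ≤ (10 * s) ^ 5 * (t + 1) ^ 4 * (((9 * s * t ^ 2) ^ t) ^ 4 * X ^ 4 *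
          (39 * s ^ 2 * t ^ 3) ^ t) := by
        have h6 : 9 * s * t ^ 2 ≤ (9 * s * t ^ 2) ^ t := Nat.le_self_pow ht.ne' _
        have h7 : 39 * s ^ 2 * t ^ 3 ≤ (39 * s ^ 2 * t ^ 3) ^ t := Nat.le_self_pow ht.ne' _
        gcongr
        omega
    _ = (10 * s) ^ 5 * (t + 1) ^ 4 * ((36 * s ^ 2 * t ^ 3) ^ (4 * t) *
          (39 * s ^ 2 * t ^ 3) ^ t) := by
        rw [hX, ← mul_pow, ← mul_pow, mul_comm 4 t, pow_mul]
        ring_nf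
    _ ≤ (10 * s) ^ 5 * (t + 1) ^ 4 * ((39 * s ^ 2 * t ^ 3) ^ (4 * t) *
          (39 * s ^ 2 * t ^ 3) ^ t) := by
        gcongr
        omega
    _ = _ := by rw [← pow_add]; congr 2; ring

lemma dominates_of_lower_bound (Q I D : ℕ → ℕ) (W K e N : ℕ) (hW : 0 < W) (hK : 2 ≤ K)
    (he : e ≤ K ^ 2) (hID : ∀ M : ℕ, (M ^ 2 - K * M - e : ℤ) ≤ W * ((I M : ℤ) - D M))
    (hQ : ∑ w ∈ (Finset.range (N + 1)).filter (fun w => N < w + 2 * K), Q w ≤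
      (4 * K ^ 2 + 2 * K) * ∑ w ∈ (Finset.range (N + 1)).filter (fun w => w + 4 * K ^ 2 ≤ N), Q w) :
    ∑ ij ∈ Finset.HasAntidiagonal.antidiagonal N, D ij.1 * Q ij.2 ≤
      ∑ ij ∈ Finset.HasAntidiagonal.antidiagonal N, I ij.1 * Q ij.2 := by
  have heZ : (e : ℤ) ≤ K ^ 2 := by exact_mod_cast he
  have hKZ : (2 : ℤ) ≤ K := by exact_mod_cast hK
  have key :=
    sum_mul_nonneg_of_window Q (fun M => W * ((I M : ℤ) - D M)) N (2 * K) (4 * K ^ 2)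
    (4 * K ^ 2 + 2 * K) (2 * K ^ 2) (by nlinarith) ?_ ?_ ?_ hQ
  · have h : ∀ f : ℕ → ℕ, ((∑ ij ∈ Finset.HasAntidiagonal.antidiagonal N, f ij.1 * Q ij.2 : ℕ) : ℤ) =
        ∑ w ∈ Finset.range (N + 1), (Q w : ℤ) * f (N - w) := by
      intro f
      rw [← Finset.Nat.sum_antidiagonal_swap,
        Finset.Nat.sum_antidiagonal_eq_sum_range_succ_mk]
      push_cast
      exact Finset.sum_congr rfl fun w _ => mul_comm _ _
    zify
    have h1 := h D
    have h2 := h I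
    push_cast at h1 h2
    rw [h1, h2, ← sub_nonneg, ← Finset.sum_sub_distrib]
    have h3 : ∑ w ∈ Finset.range (N + 1), (Q w : ℤ) * (W * ((I (N - w) : ℤ) - D (N - w))) =
        W * ∑ w ∈ Finset.range (N + 1), ((Q w : ℤ) * I (N - w) - Q w * D (N - w)) := by
      rw [Finset.mul_sum]
      exact Finset.sum_congr rfl fun w _ => by ring
    rw [h3] at key
    exact nonneg_of_mul_nonneg_right key (by exact_mod_cast hW)
  · intro M
    have := hID M
    push_cast
    nlinarith [sq_nonneg (2 * (M : ℤ) - K), sq_nonneg (K : ℤ)]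
  · intro M hM
    have := hID M
    have hM : (2 * K : ℤ) ≤ M := by exact_mod_cast hM
    nlinarith
  · intro M hM
    have := hID M
    have hM : (4 * K ^ 2 : ℤ) ≤ M := by exact_mod_cast hM
    have h1 : (4 * K ^ 2 * (4 * K ^ 2 - K) : ℤ) ≤ M * (M - K) := by
      refine mul_le_mul hM (by linarith) (by nlinarith) (by linarith [sq_nonneg (K : ℤ)])
    have h2 : (2 * K ^ 3 : ℤ) ≤ K ^ 4 := by
      nlinarith [mul_le_mul_of_nonneg_right hKZ (by positivity : (0 : ℤ) ≤ (K : ℤ) ^ 3)]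
    have h3 : (2 * K ^ 2 : ℤ) ≤ K ^ 3 := by
      nlinarith [mul_le_mul_of_nonneg_right hKZ (by positivity : (0 : ℤ) ≤ (K : ℤ) ^ 2)]
    push_cast
    nlinarith [sq_nonneg (K : ℤ)]

/-- Let `L, s` be positive integers and `V ⊆ {s+1, …, L+s}` nonempty
with `t = |V|` satisfying `t ≤ (L-2)/2` (i.e. `2t + 2 ≤ L`). Then for every
`N ≥ (10s)^5 (t+1)^4 (39 s² t³)^{5t}`, the number of partitions of `N` in `I_{L,s,V}`
is at least the number of partitions of `N` in `D_{L,s,V}` (nonempty partitions with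
all parts in `{s+1, …, L+s}` such that every `k ∈ V` occurs with multiplicity a
perfect `t`-th power). -/
theorem impermissible_set_vs_perfect_power_frequencies (L s : ℕ) (hL : 0 < L)
    (hs : 0 < s) (V : Finset ℕ) (hV : V ⊆ Finset.Icc (s + 1) (L + s))
    (hVne : V.Nonempty) (t : ℕ) (ht : t = V.card) (htL : 2 * t + 2 ≤ L)
    (N : ℕ) (hN : (10 * s) ^ 5 * (t + 1) ^ 4 * (39 * s ^ 2 * t ^ 3) ^ (5 * t) ≤ N) :
    Nat.card {p : N.Partition //
        p.parts ≠ 0 ∧ (∀ x ∈ p.parts, s + 1 ≤ x ∧ x ≤ L + s) ∧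
          ∀ k ∈ V, ∃ m : ℕ, p.parts.count k = m ^ t} ≤
    Nat.card {p : N.Partition //
        s ∈ p.parts ∧ (∀ x ∈ p.parts, s ≤ x ∧ x ≤ L + s) ∧ ∀ x ∈ p.parts, x ∉ V} := by
  classical
  have ht0 : 0 < t := ht ▸ hVne.card_pos
  have hVlb : ∀ k ∈ V, s + 1 ≤ k := fun k hk => (Finset.mem_Icc.1 (hV hk)).1
  obtain ⟨a, ha1, ha2, haV, haV'⟩ := exists_consecutive_notMem V s
  rw [← ht] at ha2
  have hthr := threshold_bound s t a N hs ht0 ha2 hN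
  have hapos : 0 < a := by omega
  set c := a * (a + 1) with hcdef
  set E := ((2 * s + 2) * t) ^ t with hEdef
  set K := s * (2 * s + 1) * (1 + 2 * E) + 2 * c * (4 * s + 1) with hKdef
  have hc0 : 0 < c := by positivity
  set pair : Finset ℕ := {a, a + 1} with hpair
  have hpairmem : ∀ x, x ∈ pair ↔ x = a ∨ x = a + 1 := fun x => by simp [hpair]
  set A := (Finset.Icc (s + 1) (L + s) \ V) \ pair with hA
  have hAmem : ∀ x, x ∈ A ↔ ((s + 1 ≤ x ∧ x ≤ L + s) ∧ x ∉ V) ∧ x ∉ pair := fun x => by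
    simp only [hA, Finset.mem_sdiff, Finset.mem_Icc]
  set Q : ℕ → ℕ := fun n => (partitionsWith (fun m => ∀ x ∈ m, x ∈ A) n).card with hQ
  set p : ℕ → ℕ := fun n => (partitionsWith (fun m => ∀ x ∈ m, x ∈ pair) n).card with hp
  set r : ℕ → ℕ := fun n => (partitionsWith (IsPowerSupported V t) n).card with hr
  set σ : ℕ → ℕ := fun n => (partitionsWith (fun m => s ∈ m ∧ ∀ x ∈ m, x ∈ ({s} : Finset ℕ)) n).card
    with hσ
  set D : ℕ → ℕ := fun M => ∑ ij ∈ Finset.HasAntidiagonal.antidiagonal M, r ij.1 * p ij.2 with hD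
  set I : ℕ → ℕ := fun M => ∑ ij ∈ Finset.HasAntidiagonal.antidiagonal M, σ ij.1 * p ij.2 with hI
  have hpu : ∀ n, c * p n ≤ n + c := fun n => by
    have := Nat.mul_le_mul_left c (card_partitionsWith_pair_le a hapos n)
    have h2 := Nat.mul_div_le n c
    rw [← hcdef, mul_add] at this
    change c * p n ≤ _ at this
    omega
  have hpl : ∀ n, n ≤ c * p n + c := fun n => by
    have := Nat.mul_le_mul_left c (le_card_partitionsWith_pair a hapos n)
    have h2 := Nat.lt_mul_div_succ n hc0
    rw [mul_add] at h2
    change _ ≤ c * p n at this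
    rw [← hcdef] at this
    omega
  have hσ1 : ∀ i, 0 < i → 1 ≤ σ (s * i) := fun i hi => by
    refine Finset.card_pos.2 ⟨Multiset.replicate i s, mem_partitionsWith.2 ⟨⟨?_, ?_⟩, ?_, ?_⟩⟩
    · exact Multiset.mem_replicate.2 ⟨hi.ne', rfl⟩
    · intro x hx
      rw [Multiset.eq_of_mem_replicate hx, Finset.mem_singleton]
    · intro x hx
      rwa [Multiset.eq_of_mem_replicate hx]
    · rw [Multiset.sum_replicate, smul_eq_mul, mul_comm]
  have hID : ∀ M : ℕ, ((M : ℤ) ^ 2 - K * M - (2 * s * (2 * s + 1) * c * E : ℕ)) ≤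
      (2 * s * (2 * s + 1) * c : ℕ) * ((I M : ℤ) - D M) := by
    intro M
    have h1 := convolution_le r p s c E M
      (fun j => mul_sum_card_isPowerSupported_le V t s j ht0 ht.symm hVlb) hpu
    have h2 := le_convolution σ p s c M hs hσ1 hpl
    have h3 := mul_le_mul_of_nonneg_left h1 (by positivity : (0 : ℤ) ≤ 2 * s)
    have h4 := mul_le_mul_of_nonneg_left h2 (by positivity : (0 : ℤ) ≤ 2 * s + 1)
    simp only [hI, hD, hKdef]
    push_cast
    linarith
  have hK2 : 2 ≤ K := by
    have : 1 ≤ c * (4 * s + 1) := Nat.mul_pos hc0 (by omega)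
    rw [hKdef, mul_assoc 2]
    omega
  have hWE : 2 * s * (2 * s + 1) * c * E ≤ K ^ 2 := by
    have h1 : s * (2 * s + 1) * (2 * E) ≤ K := by rw [hKdef]; nlinarith
    have h2 : c ≤ K := by rw [hKdef]; nlinarith
    calc _ = s * (2 * s + 1) * (2 * E) * c := by ring
      _ ≤ K * K := Nat.mul_le_mul h1 h2
      _ = _ := by ring
  have hApos : ∀ b ∈ A, 0 < b := fun b hb => by
    have := ((hAmem b).1 hb).1.1
    omega
  have hwin := sum_window_card_partitionsWith_le A hApos (4 * K ^ 2) (2 * K) N (by positivity) (by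
    have : (4 * K ^ 2) ^ 2 + 2 * K ≤ 17 * K ^ 4 := by
      have h1 : K * 2 ^ 3 ≤ K * K ^ 3 := Nat.mul_le_mul_left _ (Nat.pow_le_pow_left hK2 3)
      nlinarith
    exact this.trans hthr)
  have hmain := dominates_of_lower_bound Q I D _ K _ N (by positivity) hK2 hWE hID hwin
  rw [natCard_partition_subtype (fun m => m ≠ 0 ∧ (∀ x ∈ m, s + 1 ≤ x ∧ x ≤ L + s) ∧
      ∀ k ∈ V, ∃ r : ℕ, m.count k = r ^ t),
    natCard_partition_subtype (fun m => s ∈ m ∧ (∀ x ∈ m, s ≤ x ∧ x ≤ L + s) ∧ ∀ x ∈ m, x ∉ V)]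
  have hspair : s ∉ pair := fun h => by have := (hpairmem s).1 h; omega
  have hDle : ∀ M, (partitionsWith (fun m => (∀ x ∈ m, x ∈ V ∪ pair) ∧
      ∀ k ∈ V, ∃ r : ℕ, m.count k = r ^ t) M).card ≤ D M := by
    refine card_partitionsWith_le_sum_antidiagonal V ?_ ?_
    · rintro m ⟨-, hm⟩
      refine ⟨fun x hx => (Multiset.mem_filter.1 hx).2, fun k hk => ?_⟩
      rw [Multiset.count_filter_of_pos hk]
      exact hm k hk
    · rintro m ⟨hm, -⟩ x hx
      obtain ⟨hx, hxV⟩ := Multiset.mem_filter.1 hx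
      exact (Finset.mem_union.1 (hm x hx)).resolve_left hxV
  have hIge : ∀ M, I M ≤ (partitionsWith (fun m => s ∈ m ∧ ∀ x ∈ m, x ∈ insert s pair) M).card := by
    refine sum_antidiagonal_le_card_partitionsWith {s} ?_ (fun m hm => hm.2) ?_
    · rintro x y ⟨hsx, hx⟩ hy
      refine ⟨Multiset.mem_add.2 (Or.inl hsx), fun z hz => ?_⟩
      rcases Multiset.mem_add.1 hz with hz | hz
      · rw [Finset.mem_singleton.1 (hx z hz)]; exact Finset.mem_insert_self _ _
      · exact Finset.mem_insert_of_mem (hy z hz)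
    · intro m hm x hx hxs
      rw [Finset.mem_singleton.1 hxs] at hx
      exact hspair (hm s hx)
  refine (card_partitionsWith_le_sum_antidiagonal (V ∪ pair)
    (Φ₁ := fun m => (∀ x ∈ m, x ∈ V ∪ pair) ∧ ∀ k ∈ V, ∃ r : ℕ, m.count k = r ^ t)
    (Φ₂ := fun m => ∀ x ∈ m, x ∈ A) ?_ ?_ N).trans ?_
  · rintro m ⟨-, -, hm⟩
    refine ⟨fun x hx => (Multiset.mem_filter.1 hx).2, fun k hk => ?_⟩
    rw [Multiset.count_filter_of_pos (Finset.mem_union_left _ hk)]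
    exact hm k hk
  · rintro m ⟨-, hm, -⟩ x hx
    obtain ⟨hx, hxV⟩ := Multiset.mem_filter.1 hx
    rw [Finset.mem_union, not_or] at hxV
    exact (hAmem x).2 ⟨⟨hm x hx, hxV.1⟩, hxV.2⟩
  refine (Finset.sum_le_sum fun ij _ => Nat.mul_le_mul_right _ (hDle ij.1)).trans
    (hmain.trans ((Finset.sum_le_sum fun ij _ => Nat.mul_le_mul_right _ (hIge ij.1)).trans ?_))
  refine sum_antidiagonal_le_card_partitionsWith (insert s pair) ?_ (fun m hm => hm.2) ?_ N
  · rintro x y ⟨hsx, hx⟩ hy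
    have hall : ∀ z ∈ x + y, (s ≤ z ∧ z ≤ L + s) ∧ z ∉ V := by
      intro z hz
      rcases Multiset.mem_add.1 hz with hz | hz
      · rcases Finset.mem_insert.1 (hx z hz) with rfl | h
        · exact ⟨⟨le_rfl, by omega⟩, fun h => by have := hVlb _ h; omega⟩
        · rcases (hpairmem z).1 h with rfl | rfl
          · exact ⟨⟨by omega, by omega⟩, haV⟩
          · exact ⟨⟨by omega, by omega⟩, haV'⟩
      · have := ((hAmem z).1 (hy z hz)).1
        exact ⟨⟨by omega, this.1.2⟩, this.2⟩
    exact ⟨Multiset.mem_add.2 (Or.inl hsx), fun z hz => (hall z hz).1, fun z hz => (hall z hz).2⟩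
  · intro m hm x hx hxi
    have := (hAmem x).1 (hm x hx)
    rcases Finset.mem_insert.1 hxi with rfl | h
    · omega
    · exact this.2 h
end
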